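/- Let v ∈ N be such that M := 𝒟v is a W-lattice, and set Λ₀ = M_τ = ∑_{i≥0} τ^i(M). Then for every j with 0 ≤ j ≤ g−1: (i) M ∩ F^j(Λ₀) equals the sum of the W-span of {F^a V^b v : a, b ≥ 0, a+b = j} and M ∩ F^{j+1}(Λ₀); and (ii) whenever coefficients c_{a,b} ∈ W (for a, b ≥ 0 with a+b = j) satisfy ∑_{a+b=j} c_{a,b}·F^a V^b v ∈ F^{j+1}(Λ₀), all c_{a,b} lie in pW. (Equivalently, the images of the j+1 vectors F^a V^b v with a+b = j form a basis of the image of M ∩ F^j(Λ₀) in the k-vector space F^j(Λ₀)/F^{j+1}(Λ₀).) -/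

import Mathlib

noncomputable section

open WittVector
open scoped Isocrystal

variable (p : ℕ) [Fact p.Prime] (k : Type*) [Field k] [IsAlgClosed k] [CharP k p]

/-- The Frobenius automorphism `σ` of `K(p, k) = Frac(W(k))`, the unique extension of the
Witt vector Frobenius (itself the unique lift of `x ↦ x^p` on `k`). -/
def sigmaK : K(p, k) ≃+* K(p, k) := WittVector.FractionRing.frobenius p k

variable (g : ℕ)

/-- `N = K^{2g}`: a pair `(x, y)` encodes the vector `∑ᵢ xᵢ·eᵢ + ∑ᵢ yᵢ·fᵢ` in the basis
`e_1, …, e_g, f_1, …, f_g`. -/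
abbrev Nspace := (Fin g → K(p, k)) × (Fin g → K(p, k))

/-- The basis vector `e_i` (0-indexed). -/
def eVec (i : Fin g) : Nspace p k g := (Pi.single i 1, 0)

/-- The basis vector `f_i` (0-indexed). -/
def fVec (i : Fin g) : Nspace p k g := (0, Pi.single i 1)

/-- The `σ`-semilinear Frobenius `F : N → N`, with `F(e_i) = f_i`, `F(f_i) = p·e_i`. -/
def Fmap (v : Nspace p k g) : Nspace p k g :=
  (fun i => (p : K(p, k)) * sigmaK p k (v.2 i), fun i => sigmaK p k (v.1 i))

/-- The Verschiebung `V = p·F⁻¹ : N → N`, with `V(e_i) = f_i`, `V(f_i) = p·e_i`,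
`σ⁻¹`-semilinear. -/
def Vmap (v : Nspace p k g) : Nspace p k g :=
  (fun i => (p : K(p, k)) * (sigmaK p k).symm (v.2 i), fun i => (sigmaK p k).symm (v.1 i))

/-- `τ = p⁻¹·F²` acts coordinatewise by `σ²`. -/
def tauMap (v : Nspace p k g) : Nspace p k g :=
  (fun i => sigmaK p k (sigmaK p k (v.1 i)), fun i => sigmaK p k (sigmaK p k (v.2 i)))

/-- A `W`-lattice in `N`: a finitely generated `W(k)`-submodule spanning `N` over `K`. -/
def IsLattice (L : Submodule (WittVector p k) (Nspace p k g)) : Prop :=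
  L.FG ∧ Submodule.span K(p, k) (L : Set (Nspace p k g)) = ⊤

/-- A Dieudonné lattice: a `W`-lattice `M` with `F(M) ⊆ M` and `p·M ⊆ F(M)`. -/
def IsDieudonneLattice (M : Submodule (WittVector p k) (Nspace p k g)) : Prop :=
  IsLattice p k g M ∧ (∀ v ∈ M, Fmap p k g v ∈ M) ∧
    ∀ v ∈ M, ∃ w ∈ M, Fmap p k g w = (p : K(p, k)) • v

/-- `L` is `τ`-stable: `τ(L) ⊆ L`. -/
def TauStable (L : Submodule (WittVector p k) (Nspace p k g)) : Prop :=
  ∀ v ∈ L, tauMap p k g v ∈ L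

/-- `M_τ = ∑_{i ≥ 0} τ^i(M)`, the `W(k)`-submodule generated by all iterates of `τ`
applied to `M`. -/
def Mtau (M : Submodule (WittVector p k) (Nspace p k g)) :
    Submodule (WittVector p k) (Nspace p k g) :=
  Submodule.span (WittVector p k) (⋃ i : ℕ, (tauMap p k g)^[i] '' (M : Set (Nspace p k g)))

/-- The symplectic pairing with `⟨e_i, f_{g+1−i}⟩ = 1`, `⟨f_i, e_{g+1−i}⟩ = −1` and all
other pairings of basis vectors zero. -/
def pairN (v w : Nspace p k g) : K(p, k) :=
  ∑ i : Fin g, (v.1 i * w.2 (Fin.rev i) - v.2 i * w.1 (Fin.rev i))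

/-- The dual `L^∨ = {x ∈ N : ⟨x, m⟩ ∈ W for all m ∈ L}` of a set `L ⊆ N`. -/
def dualSet (L : Set (Nspace p k g)) : Set (Nspace p k g) :=
  {x | ∀ m ∈ L, ∃ w : WittVector p k, algebraMap (WittVector p k) K(p, k) w = pairN p k g x m}

/-- `𝒟v`: the `W(k)`-submodule generated by all `F^a V^b v`, `a, b ≥ 0`. -/
def Dspan (v : Nspace p k g) : Submodule (WittVector p k) (Nspace p k g) :=
  Submodule.span (WittVector p k)
    {w | ∃ a b : ℕ, w = (Fmap p k g)^[a] ((Vmap p k g)^[b] v)}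

set_option linter.unusedSectionVars false

section SemilinearFrobenius

variable {R N : Type*} [CommRing R] [AddCommGroup N] [Module R N]
  {σ θ θ' : R →+* R} [RingHomSurjective σ]
  [RingHomInvPair θ θ'] [RingHomInvPair θ' θ]
  (F : N →ₛₗ[σ] N) (T : N ≃ₛₗ[θ] N) {π : R}

/-- The filtration `L, F L, F² L, …` of submodules attached to a semilinear endomorphism. -/
def frobFil (L : Submodule R N) : ℕ → Submodule R N
  | 0 => L
  | n + 1 => (frobFil L n).map F

lemma coe_frobFil (L : Submodule R N) (n : ℕ) :
    (frobFil F L n : Set N) = F^[n] '' (L : Set N) := by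
  induction n with
  | zero => simp [frobFil]
  | succ n ih =>
    rw [frobFil, Submodule.map_coe, ih, Function.iterate_succ', Set.image_comp]

variable {F} {L : Submodule R N}

lemma frobFil_succ_le (hF : L.map F ≤ L) (n : ℕ) : frobFil F L (n + 1) ≤ frobFil F L n := by
  induction n with
  | zero => exact hF
  | succ n ih => exact Submodule.map_mono ih

lemma frobFil_antitone (hF : L.map F ≤ L) : Antitone (frobFil F L) :=
  antitone_nat_of_succ_le (frobFil_succ_le hF)

variable {T}

/-- If `L` cannot be generated by fewer than `2r` elements and is generated modulo `F L` by the
vectors `Tⁱ v`, then fewer than `r` of these vectors do not generate `L` modulo `F L`. -/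
lemma iterate_not_mem_span_sup [IsLocalRing R]
    (hπ : π ∈ IsLocalRing.maximalIdeal R) (hFF : ∀ x, F (F x) = π • T x)
    (hTL : ∀ x, T x ∈ L ↔ x ∈ L) (hcomm : ∀ x, F (T x) = T (F x))
    (hfg : L.FG) {r : ℕ}
    (hrank : ∀ s : Finset N, L ≤ Submodule.span R (s : Set N) → 2 * r ≤ s.card)
    {v : N} (hgen : L ≤ Submodule.span R (Set.range fun i : ℕ => T^[i] v) ⊔ L.map F)
    {n : ℕ} (hn : n < r) :
    T^[n] v ∉ Submodule.span R (Set.range fun i : Fin n => T^[i] v) ⊔ L.map F := by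
  classical
  intro h
  set U := Submodule.span R (Set.range fun i : Fin n => T^[i] v) with hU
  have hstab : (U ⊔ L.map F).map (T : N →ₛₗ[θ] N) ≤ U ⊔ L.map F := by
    rw [Submodule.map_sup, hU, Submodule.map_span]
    refine sup_le (Submodule.span_le.2 ?_) ?_
    · rintro _ ⟨_, ⟨i, rfl⟩, rfl⟩
      change T (T^[i] v) ∈ _
      rw [← Function.iterate_succ_apply' T]
      rcases Nat.lt_or_ge (i + 1) n with hi | hi
      · exact Submodule.mem_sup_left (Submodule.subset_span ⟨⟨i + 1, hi⟩, rfl⟩)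
      · rwa [show (i : ℕ).succ = n by omega]
    · rintro _ ⟨_, ⟨x, hx, rfl⟩, rfl⟩
      exact Submodule.mem_sup_right ⟨T x, (hTL x).2 hx, hcomm x⟩
  have hv : ∀ i, T^[i] v ∈ U ⊔ L.map F := by
    intro i
    induction i with
    | zero =>
      rcases Nat.eq_zero_or_pos n with rfl | h0
      · exact h
      · exact Submodule.mem_sup_left (Submodule.subset_span ⟨⟨0, h0⟩, rfl⟩)
    | succ i ih =>
      rw [Function.iterate_succ_apply']
      exact hstab ⟨_, ih, rfl⟩
  have hL : L ≤ U ⊔ L.map F :=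
    hgen.trans (sup_le (Submodule.span_le.2 (by rintro _ ⟨i, rfl⟩; exact hv i)) le_sup_right)
  have hFL : L.map F ≤ U.map F ⊔ IsLocalRing.maximalIdeal R • L := by
    refine (Submodule.map_mono hL).trans ?_
    rw [Submodule.map_sup]
    refine sup_le_sup_left ?_ _
    rintro _ ⟨_, ⟨x, hx, rfl⟩, rfl⟩
    rw [hFF]
    exact Submodule.smul_mem_smul hπ ((hTL x).2 hx)
  have hnak : L ≤ U ⊔ U.map F := by
    refine Submodule.le_of_le_smul_of_le_jacobson_bot (I := IsLocalRing.maximalIdeal R) hfg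
      (IsLocalRing.maximalIdeal_le_jacobson _) ?_
    exact hL.trans (sup_le (le_sup_left.trans le_sup_left)
      (hFL.trans (sup_le_sup_right le_sup_right _)))
  let s : Finset N := Finset.univ.image (fun i : Fin n => T^[i] v) ∪
    Finset.univ.image (fun i : Fin n => F (T^[i] v))
  have hs : L ≤ Submodule.span R (s : Set N) := by
    refine hnak.trans (le_of_eq ?_)
    simp only [s, Finset.coe_union, Finset.coe_image, Finset.coe_univ, Set.image_univ,
      Submodule.span_union, hU, Submodule.map_span]
    rw [← Set.range_comp]
    rfl
  have h1 := hrank s hs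
  have h2 : s.card ≤ n + n := (Finset.card_union_le _ _).trans
    (add_le_add (Finset.card_image_le.trans (by simp)) (Finset.card_image_le.trans (by simp)))
  omega

lemma smul_mem_map_of_mem (hFF : ∀ x, F (F x) = π • T x) (hF : L.map F ≤ L)
    (hTL : ∀ x, T x ∈ L ↔ x ∈ L) {x : N} (hx : x ∈ L) : π • x ∈ L.map F := by
  refine ⟨F (T.symm x), hF ⟨_, (hTL _).1 (by simpa using hx), rfl⟩, ?_⟩
  rw [hFF, LinearEquiv.apply_symm_apply]

/-- The vectors `v, T v, …, T^(n-1) v` are independent in `L / F L` for `n ≤ r`. -/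
lemma dvd_of_sum_mem_map [IsLocalRing R]
    (hπ : IsLocalRing.maximalIdeal R = Ideal.span {π}) (hFF : ∀ x, F (F x) = π • T x)
    (hF : L.map F ≤ L) (hTL : ∀ x, T x ∈ L ↔ x ∈ L) (hcomm : ∀ x, F (T x) = T (F x))
    (hfg : L.FG) {r : ℕ}
    (hrank : ∀ s : Finset N, L ≤ Submodule.span R (s : Set N) → 2 * r ≤ s.card)
    {v : N} (hv : v ∈ L)
    (hgen : L ≤ Submodule.span R (Set.range fun i : ℕ => T^[i] v) ⊔ L.map F)
    {n : ℕ} (hn : n ≤ r) (c : Fin n → R) (hc : ∑ i, c i • T^[i] v ∈ L.map F) (i : Fin n) :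
    π ∣ c i := by
  induction n with
  | zero => exact i.elim0
  | succ n ih =>
    rw [Fin.sum_univ_castSucc] at hc
    have hlast : π ∣ c (Fin.last n) := by
      by_contra hnd
      have hunit : IsUnit (c (Fin.last n)) := by
        by_contra hu
        have : c (Fin.last n) ∈ IsLocalRing.maximalIdeal R := hu
        rw [hπ, Ideal.mem_span_singleton] at this
        exact hnd this
      refine iterate_not_mem_span_sup (hπ ▸ Ideal.mem_span_singleton_self π) hFF hTL hcomm hfg
        hrank hgen hn ?_
      obtain ⟨u, hu⟩ := hunit
      have hmem : (c (Fin.last n)) • T^[n] v ∈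
          Submodule.span R (Set.range fun i : Fin n => T^[i] v) ⊔ L.map F := by
        refine (Submodule.add_mem_iff_right _ ?_).1 (Submodule.mem_sup_right hc)
        exact Submodule.mem_sup_left (Submodule.sum_mem _ fun i _ =>
          Submodule.smul_mem _ _ (Submodule.subset_span ⟨i, rfl⟩))
      rw [← hu] at hmem
      exact (Submodule.smul_mem_iff_of_isUnit _ u.isUnit).1 hmem
    have hTv : ∀ m : ℕ, T^[m] v ∈ L := by
      intro m
      induction m with
      | zero => exact hv
      | succ m ihm => rw [Function.iterate_succ_apply']; exact (hTL _).2 ihm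
    refine Fin.lastCases hlast (fun i => ?_) i
    refine ih (by omega) (fun i => c i.castSucc) ?_ i
    refine (Submodule.add_mem_iff_left _ ?_).1 hc
    obtain ⟨d, hd⟩ := hlast
    rw [hd, mul_comm, mul_smul]
    exact Submodule.smul_mem _ _ (smul_mem_map_of_mem hFF hF hTL (hTv _))

lemma dvd_of_sum_mem_frobFil (hinj : Function.Injective F) (hσ : σ π = π) {ι : Type*} [Fintype ι]
    {y : ι → N} (h : ∀ c : ι → R, ∑ i, c i • y i ∈ L.map F → ∀ i, π ∣ c i) (j : ℕ)
    (c : ι → R) (hc : ∑ i, c i • F^[j] (y i) ∈ frobFil F L (j + 1)) (i : ι) : π ∣ c i := by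
  induction j generalizing c with
  | zero => exact h c hc i
  | succ j ih =>
    choose d hd using fun i => RingHomSurjective.is_surjective (σ := σ) (c i)
    have hsum : ∑ i, c i • F^[j + 1] (y i) = F (∑ i, d i • F^[j] (y i)) := by
      simp only [map_sum, map_smulₛₗ, Function.iterate_succ_apply', hd]
    rw [hsum] at hc
    obtain ⟨x, hx, hxe⟩ := hc
    rw [hinj hxe] at hx
    rw [← hd i, ← hσ]
    exact map_dvd σ (ih d hx)

lemma symm_iterate_mem (hTL : ∀ x, T x ∈ L ↔ x ∈ L) {x : N} (hx : x ∈ L) (n : ℕ) :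
    T.symm^[n] x ∈ L := by
  induction n with
  | zero => exact hx
  | succ n ih => rw [Function.iterate_succ_apply']; exact (hTL _).1 (by simpa using ih)

lemma iterate_symm_iterate (n : ℕ) (x : N) : T^[n] (T.symm^[n] x) = x :=
  (Function.LeftInverse.iterate T.apply_symm_apply n) x

section Words

variable {V : N → N} {v : N}

lemma iterate_iterate_eq (hV : ∀ x, T (V x) = F x) (hcomm : ∀ x, F (T x) = T (F x))
    (a b : ℕ) : F^[a] (V^[b] v) = F^[a + b] (T.symm^[b] v) := by
  have hsymm : Function.Commute T.symm F := fun x => by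
    apply T.injective
    rw [← hcomm, T.apply_symm_apply, T.apply_symm_apply]
  have hVeq : V = T.symm ∘ F := by
    funext x
    exact T.injective (by simp [hV])
  rw [hVeq, hsymm.comp_iterate, Function.comp_apply,
    (hsymm.iterate_iterate b b).eq v, Function.iterate_add_apply]

lemma word_mem_frobFil (hV : ∀ x, T (V x) = F x) (hcomm : ∀ x, F (T x) = T (F x))
    (hTL : ∀ x, T x ∈ L ↔ x ∈ L) (hv : v ∈ L) (a b : ℕ) :
    F^[a] (V^[b] v) ∈ frobFil F L (a + b) := by
  rw [iterate_iterate_eq hV hcomm, ← SetLike.mem_coe, coe_frobFil]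
  exact ⟨_, symm_iterate_mem hTL hv b, rfl⟩

lemma dvd_of_sum_word_mem [IsLocalRing R] (hV : ∀ x, T (V x) = F x) (hcomm : ∀ x, F (T x) = T (F x))
    (hinj : Function.Injective F) (hσ : σ π = π)
    (hπ : IsLocalRing.maximalIdeal R = Ideal.span {π}) (hFF : ∀ x, F (F x) = π • T x)
    (hF : L.map F ≤ L) (hTL : ∀ x, T x ∈ L ↔ x ∈ L)
    (hfg : L.FG) {r : ℕ}
    (hrank : ∀ s : Finset N, L ≤ Submodule.span R (s : Set N) → 2 * r ≤ s.card)
    (hv : v ∈ L) (hgen : L ≤ Submodule.span R (Set.range fun i : ℕ => T^[i] v) ⊔ L.map F)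
    {j : ℕ} (hj : j < r) (c : Fin (j + 1) → R)
    (hc : ∑ a, c a • F^[(a : ℕ)] (V^[j - (a : ℕ)] v) ∈ frobFil F L (j + 1)) (a : Fin (j + 1)) :
    π ∣ c a := by
  have hv' : T.symm^[j] v ∈ L := symm_iterate_mem hTL hv j
  refine dvd_of_sum_mem_frobFil (y := fun a : Fin (j + 1) => T^[(a : ℕ)] (T.symm^[j] v)) hinj hσ
    (fun c hc => dvd_of_sum_mem_map hπ hFF hF hTL hcomm hfg hrank hv' ?_ hj c hc) j c ?_ a
  · refine hgen.trans (sup_le_sup_right (Submodule.span_mono ?_) _)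
    rintro _ ⟨i, rfl⟩
    refine ⟨i + j, ?_⟩
    simp only [Function.iterate_add_apply, iterate_symm_iterate]
  · have hword : ∀ a : Fin (j + 1), F^[(a : ℕ)] (V^[j - (a : ℕ)] v) =
        F^[j] (T^[(a : ℕ)] (T.symm^[j] v)) := fun a => by
      have ha : (a : ℕ) + (j - a) = j := by omega
      rw [iterate_iterate_eq hV hcomm, ha]
      rw [← iterate_symm_iterate (T := T) a (T.symm^[j - (a : ℕ)] v),
        ← Function.iterate_add_apply T.symm, ha]
    simpa only [hword] using hc

end Words

section Filtration

variable {V : N → N} {v : N}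

/-- The span of the words `Fᵃ Vᵇ v` of length at least `j`. -/
def wordSpan (F : N →ₛₗ[σ] N) (V : N → N) (v : N) (j : ℕ) : Submodule R N :=
  Submodule.span R {w | ∃ a b : ℕ, j ≤ a + b ∧ w = F^[a] (V^[b] v)}

lemma wordSpan_le (j : ℕ) : wordSpan F V v j ≤
    Submodule.span R (Set.range fun a : Fin (j + 1) => F^[(a : ℕ)] (V^[j - (a : ℕ)] v)) ⊔
      wordSpan F V v (j + 1) := by
  refine Submodule.span_le.2 ?_
  rintro _ ⟨a, b, hab, rfl⟩
  rcases hab.eq_or_lt with rfl | h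
  · refine Submodule.mem_sup_left (Submodule.subset_span ⟨⟨a, by omega⟩, ?_⟩)
    simp
  · exact Submodule.mem_sup_right (Submodule.subset_span ⟨a, b, h, rfl⟩)

lemma wordSpan_le_zero (j : ℕ) : wordSpan F V v j ≤ wordSpan F V v 0 := by
  refine Submodule.span_mono ?_
  rintro _ ⟨a, b, -, rfl⟩
  exact ⟨a, b, Nat.zero_le _, rfl⟩

lemma wordSpan_le_frobFil (hF : L.map F ≤ L)
    (hword : ∀ a b, F^[a] (V^[b] v) ∈ frobFil F L (a + b)) (j : ℕ) :
    wordSpan F V v j ≤ frobFil F L j := by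
  refine Submodule.span_le.2 ?_
  rintro _ ⟨a, b, hab, rfl⟩
  exact frobFil_antitone hF hab (hword a b)

lemma smul_word (hσ : σ π = π) (hFV : ∀ x, F (V x) = π • x) (a b : ℕ) :
    π • F^[a] (V^[b] v) = F^[a + 1] (V^[b + 1] v) := by
  induction a with
  | zero => simp [Function.iterate_succ_apply', hFV]
  | succ a ih =>
    rw [Function.iterate_succ_apply', Function.iterate_succ_apply' F (a + 1), ← ih, map_smulₛₗ, hσ]

lemma wordSpan_inf_frobFil_le (hσ : σ π = π) (hFV : ∀ x, F (V x) = π • x) (hF : L.map F ≤ L)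
    (hword : ∀ a b, F^[a] (V^[b] v) ∈ frobFil F L (a + b)) {r : ℕ}
    (hind : ∀ j < r, ∀ c : Fin (j + 1) → R,
      ∑ a, c a • F^[(a : ℕ)] (V^[j - (a : ℕ)] v) ∈ frobFil F L (j + 1) → ∀ a, π ∣ c a)
    {j : ℕ} (hj : j ≤ r) : wordSpan F V v 0 ⊓ frobFil F L j ≤ wordSpan F V v j := by
  induction j with
  | zero => exact inf_le_left
  | succ j ih =>
    rintro x ⟨hx0, hx⟩
    obtain ⟨e, he, s, hs, rfl⟩ := Submodule.mem_sup.1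
      (wordSpan_le j (ih (by omega) ⟨hx0, frobFil_succ_le hF j hx⟩))
    refine Submodule.add_mem _ ?_ hs
    have heF : e ∈ frobFil F L (j + 1) :=
      (Submodule.add_mem_iff_left _ (wordSpan_le_frobFil hF hword _ hs)).1 hx
    obtain ⟨c, rfl⟩ := (Submodule.mem_span_range_iff_exists_fun R).1 he
    choose d hd using hind j (by omega) c heF
    refine Submodule.sum_mem _ fun a _ => ?_
    rw [hd, mul_comm, mul_smul, smul_word hσ hFV]
    exact Submodule.smul_mem _ _ (Submodule.subset_span ⟨_, _, by omega, rfl⟩)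

end Filtration

section Saturation

variable (T) in
/-- The smallest `T`-stable submodule containing `M`. -/
def iterateSpan (M : Submodule R N) : Submodule R N :=
  Submodule.span R (⋃ i : ℕ, T^[i] '' (M : Set N))

lemma le_iterateSpan (M : Submodule R N) : M ≤ iterateSpan T M := fun x hx =>
  Submodule.subset_span (Set.mem_iUnion.2 ⟨0, x, hx, rfl⟩)

lemma map_mem_iterateSpan {M : Submodule R N} {x : N} (hx : x ∈ iterateSpan T M) :
    T x ∈ iterateSpan T M := by
  suffices h : (iterateSpan T M).map (T : N →ₛₗ[θ] N) ≤ iterateSpan T M from h ⟨x, hx, rfl⟩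
  conv_lhs => rw [iterateSpan, Submodule.map_span]
  refine Submodule.span_le.2 ?_
  rintro _ ⟨_, hy, rfl⟩
  obtain ⟨i, z, hz, rfl⟩ := Set.mem_iUnion.1 hy
  refine Submodule.subset_span (Set.mem_iUnion.2 ⟨i + 1, z, hz, ?_⟩)
  exact Function.iterate_succ_apply' T i z

lemma iterateSpan_le {M P : Submodule R N} (hM : M ≤ P) (hP : ∀ x ∈ P, T x ∈ P) :
    iterateSpan T M ≤ P := by
  refine Submodule.span_le.2 (Set.iUnion_subset fun i => ?_)
  rintro _ ⟨x, hx, rfl⟩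
  induction i with
  | zero => exact hM hx
  | succ i ih => rw [Function.iterate_succ_apply']; exact hP _ ih

/-- A submodule of a Noetherian `T`-invariant submodule that is mapped into itself by `T` is
mapped onto itself. -/
lemma map_mem_iff_of_isNoetherian {P : Submodule R N} [IsNoetherian R P]
    (hLP : L ≤ P) (hP : ∀ x, T x ∈ P ↔ x ∈ P) (hT : ∀ x ∈ L, T x ∈ L) (x : N) :
    T x ∈ L ↔ x ∈ L := by
  refine ⟨fun hx => ?_, hT x⟩
  let C : ℕ → Submodule R N := fun n => Nat.rec L (fun _ Q => Q.comap (T : N →ₛₗ[θ] N)) n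
  have hC : ∀ n y, y ∈ C n ↔ T^[n] y ∈ L := by
    intro n
    induction n with
    | zero => exact fun y => Iff.rfl
    | succ n ih => exact fun y => ih (T y)
  let f : ℕ →o Submodule R P := ⟨fun n => (C n).comap P.subtype, monotone_nat_of_le_succ
    fun n y hy => by
      refine (hC (n + 1) y).2 ?_
      rw [Function.iterate_succ_apply']
      exact hT _ ((hC _ _).1 hy)⟩
  obtain ⟨n, hn⟩ := monotone_stabilizes_iff_noetherian.2 ‹IsNoetherian R P› f
  have hTT : T^[n] (T.symm^[n] x) = x := iterate_symm_iterate n x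
  have hyP : T.symm^[n] x ∈ P := symm_iterate_mem hP ((hP x).1 (hLP hx)) n
  have h1 : (⟨_, hyP⟩ : P) ∈ f (n + 1) := by
    refine (hC (n + 1) _).2 ?_
    rw [Function.iterate_succ_apply']
    exact (congrArg (T · ∈ L) hTT).mpr hx
  rw [← hn (n + 1) (Nat.le_succ n)] at h1
  exact (congrArg (· ∈ L) hTT).mp ((hC n _).1 h1)

variable {V : N → N} {v : N}

lemma map_wordSpan_zero_le : (wordSpan F V v 0).map F ≤ wordSpan F V v 0 := by
  rw [wordSpan, Submodule.map_span]
  refine Submodule.span_mono ?_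
  rintro _ ⟨_, ⟨a, b, -, rfl⟩, rfl⟩
  exact ⟨a + 1, b, Nat.zero_le _, (Function.iterate_succ_apply' F a _).symm⟩

lemma iterate_map_comm (hcomm : ∀ x, F (T x) = T (F x)) (i : ℕ) (x : N) :
    T^[i] (F x) = F (T^[i] x) :=
  (Function.Commute.iterate_left (fun x => (hcomm x).symm : Function.Commute T F) i).eq x

lemma map_iterateSpan_le (hcomm : ∀ x, F (T x) = T (F x)) {M : Submodule R N} (hM : M.map F ≤ M) :
    (iterateSpan T M).map F ≤ iterateSpan T M := by
  conv_lhs => rw [iterateSpan, Submodule.map_span]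
  refine Submodule.span_le.2 ?_
  rintro _ ⟨_, hy, rfl⟩
  obtain ⟨i, z, hz, rfl⟩ := Set.mem_iUnion.1 hy
  exact Submodule.subset_span (Set.mem_iUnion.2 ⟨i, F z, hM ⟨z, hz, rfl⟩,
    iterate_map_comm hcomm i z⟩)

lemma iterateSpan_le_span_sup (hV : ∀ x, T (V x) = F x) (hcomm : ∀ x, F (T x) = T (F x))
    (hTL : ∀ x, T x ∈ iterateSpan T (wordSpan F V v 0) ↔ x ∈ iterateSpan T (wordSpan F V v 0)) :
    iterateSpan T (wordSpan F V v 0) ≤ Submodule.span R (Set.range fun i : ℕ => T^[i] v) ⊔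
      (iterateSpan T (wordSpan F V v 0)).map F := by
  set L := iterateSpan T (wordSpan F V v 0) with hL
  have hv : v ∈ L := le_iterateSpan _ (Submodule.subset_span ⟨0, 0, le_rfl, rfl⟩)
  have hF : L.map F ≤ L := map_iterateSpan_le hcomm map_wordSpan_zero_le
  have hTF : ∀ x, x ∈ L.map F → T x ∈ L.map F := by
    rintro _ ⟨x, hx, rfl⟩
    exact ⟨T x, (hTL x).2 hx, hcomm x⟩
  refine iterateSpan_le (Submodule.span_le.2 ?_) fun x hx => ?_
  · rintro _ ⟨a, b, -, rfl⟩
    have h := word_mem_frobFil hV hcomm hTL hv a b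
    rcases Nat.eq_zero_or_pos (a + b) with h0 | h0
    · obtain ⟨rfl, rfl⟩ : a = 0 ∧ b = 0 := by omega
      exact Submodule.mem_sup_left (Submodule.subset_span ⟨0, rfl⟩)
    · exact Submodule.mem_sup_right (frobFil_antitone hF h0 h)
  · obtain ⟨y, hy, z, hz, rfl⟩ := Submodule.mem_sup.1 hx
    rw [map_add]
    refine Submodule.add_mem _ (Submodule.mem_sup_left ?_) (Submodule.mem_sup_right (hTF z hz))
    have : T y ∈ (Submodule.span R (Set.range fun i : ℕ => T^[i] v)).map (T : N →ₛₗ[θ] N) :=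
      ⟨y, hy, rfl⟩
    rw [Submodule.map_span] at this
    refine Submodule.span_mono ?_ this
    rintro _ ⟨_, ⟨i, rfl⟩, rfl⟩
    exact ⟨i + 1, Function.iterate_succ_apply' T i v⟩

end Saturation

end SemilinearFrobenius

section Concrete

/-- The Witt vector Frobenius as a ring homomorphism. -/
abbrev frobW : WittVector p k →+* WittVector p k := (frobeniusEquiv p k : _ ≃+* _)

/-- The square of the Witt vector Frobenius, as a ring automorphism. -/
abbrev frobSqEquiv : WittVector p k ≃+* WittVector p k :=
  (frobeniusEquiv p k).trans (frobeniusEquiv p k)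

instance : RingHomSurjective (frobW p k) := ⟨(frobeniusEquiv p k).surjective⟩

instance : RingHomInvPair (frobSqEquiv p k : WittVector p k →+* WittVector p k)
    ((frobSqEquiv p k).symm : WittVector p k →+* WittVector p k) :=
  RingHomInvPair.of_ringEquiv _

instance : RingHomInvPair ((frobSqEquiv p k).symm : WittVector p k →+* WittVector p k)
    (frobSqEquiv p k : WittVector p k →+* WittVector p k) :=
  RingHomInvPair.of_ringEquiv_symm _

lemma sigmaK_algebraMap (w : WittVector p k) :
    sigmaK p k (algebraMap _ K(p, k) w) = algebraMap _ K(p, k) (frobeniusEquiv p k w) :=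
  IsFractionRing.ringEquivOfRingEquiv_algebraMap (frobeniusEquiv p k) w

lemma sigmaK_smul (w : WittVector p k) (x : K(p, k)) :
    sigmaK p k (w • x) = frobeniusEquiv p k w • sigmaK p k x := by
  rw [Algebra.smul_def, Algebra.smul_def, map_mul, sigmaK_algebraMap]

/-- `Fmap` as a semilinear map over the Witt vectors. -/
def FmapLin : Nspace p k g →ₛₗ[frobW p k] Nspace p k g where
  toFun := Fmap p k g
  map_add' x y := by
    ext i <;> simp [Fmap, mul_add]
  map_smul' w x := by
    ext i <;> simp [Fmap, sigmaK_smul]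

/-- `tauMap` as a semilinear automorphism over the Witt vectors. -/
def tauEquiv : Nspace p k g ≃ₛₗ[(frobSqEquiv p k : WittVector p k →+* WittVector p k)]
    Nspace p k g where
  toFun := tauMap p k g
  map_add' x y := by
    ext i <;> simp [tauMap]
  map_smul' w x := by
    ext i <;> simp [tauMap, sigmaK_smul]
  invFun v := (fun i => (sigmaK p k).symm ((sigmaK p k).symm (v.1 i)),
    fun i => (sigmaK p k).symm ((sigmaK p k).symm (v.2 i)))
  left_inv x := by
    ext i <;> simp [tauMap]
  right_inv x := by
    ext i <;> simp [tauMap]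

lemma natCast_p_ne_zero : (p : K(p, k)) ≠ 0 := by
  rw [← map_natCast (algebraMap (WittVector p k) K(p, k))]
  exact (map_ne_zero_iff _ (IsFractionRing.injective _ _)).2 (WittVector.p_nonzero p k)

lemma natCast_p_smul (x : Nspace p k g) : (p : WittVector p k) • x = (p : K(p, k)) • x := by
  rw [← algebraMap_smul K(p, k) (p : WittVector p k) x, map_natCast]

lemma Fmap_injective : Function.Injective (Fmap p k g) := by
  intro x y h
  have h1 := congrArg Prod.fst h
  have h2 := congrArg Prod.snd h
  ext i
  · exact (sigmaK p k).injective (congrFun h2 i)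
  · exact (sigmaK p k).injective (mul_left_cancel₀ (natCast_p_ne_zero p k) (congrFun h1 i))

lemma tauMap_Vmap (x : Nspace p k g) : tauMap p k g (Vmap p k g x) = Fmap p k g x := by
  ext i <;> simp [Vmap, Fmap, tauMap]

lemma Fmap_Vmap (x : Nspace p k g) :
    Fmap p k g (Vmap p k g x) = (p : WittVector p k) • x := by
  rw [natCast_p_smul]
  ext i <;> simp [Vmap, Fmap]

lemma Fmap_Fmap (x : Nspace p k g) :
    Fmap p k g (Fmap p k g x) = (p : WittVector p k) • tauMap p k g x := by
  rw [natCast_p_smul]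
  ext i <;> simp [Fmap, tauMap]

lemma Fmap_tauMap (x : Nspace p k g) :
    Fmap p k g (tauMap p k g x) = tauMap p k g (Fmap p k g x) := by
  ext i <;> simp [Fmap, tauMap]

lemma maximalIdeal_wittVector :
    IsLocalRing.maximalIdeal (WittVector p k) = Ideal.span {(p : WittVector p k)} :=
  (IsDiscreteValuationRing.irreducible_iff_uniformizer _).1 (WittVector.irreducible p)

lemma two_mul_le_card_of_le_span {L : Submodule (WittVector p k) (Nspace p k g)}
    (hL : Submodule.span K(p, k) (L : Set (Nspace p k g)) = ⊤) (s : Finset (Nspace p k g))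
    (hs : L ≤ Submodule.span (WittVector p k) (s : Set (Nspace p k g))) : 2 * g ≤ s.card := by
  have htop : Submodule.span K(p, k) (s : Set (Nspace p k g)) = ⊤ := by
    rw [eq_top_iff, ← hL]
    exact Submodule.span_le.2
      (hs.trans (Submodule.span_le_restrictScalars (WittVector p k) K(p, k) _))
  have h := finrank_span_finset_le_card (R := K(p, k)) s
  rw [Set.finrank, htop, finrank_top, Module.finrank_prod, Module.finrank_fin_fun] at h
  omega

/-- The vectors whose coordinates become integral after multiplication by `p ^ n`. -/
def boundedLattice (n : ℕ) : Submodule (WittVector p k) (Nspace p k g) :=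
  (LinearMap.range (((Algebra.linearMap (WittVector p k) K(p, k)).compLeft (Fin g)).prodMap
    ((Algebra.linearMap (WittVector p k) K(p, k)).compLeft (Fin g)))).comap
      (LinearMap.lsmul (WittVector p k) (Nspace p k g) ((p : WittVector p k) ^ n))

lemma mem_boundedLattice {n : ℕ} {x : Nspace p k g} : x ∈ boundedLattice p k g n ↔
    (∀ i, (p : WittVector p k) ^ n • x.1 i ∈ (algebraMap (WittVector p k) K(p, k)).range) ∧
      ∀ i, (p : WittVector p k) ^ n • x.2 i ∈ (algebraMap (WittVector p k) K(p, k)).range := by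
  constructor
  · rintro ⟨w, hw⟩
    exact ⟨fun i => ⟨w.1 i, congrFun (congrArg Prod.fst hw) i⟩,
      fun i => ⟨w.2 i, congrFun (congrArg Prod.snd hw) i⟩⟩
  · rintro ⟨h1, h2⟩
    choose a ha using h1
    choose b hb using h2
    exact ⟨(a, b), Prod.ext (funext ha) (funext hb)⟩

instance (n : ℕ) : IsNoetherian (WittVector p k) (boundedLattice p k g n) := by
  refine isNoetherian_of_injective (LinearMap.restrict (LinearMap.lsmul (WittVector p k)
    (Nspace p k g) ((p : WittVector p k) ^ n)) (q := LinearMap.range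
      (((Algebra.linearMap (WittVector p k) K(p, k)).compLeft (Fin g)).prodMap
        ((Algebra.linearMap (WittVector p k) K(p, k)).compLeft (Fin g)))) fun x hx => hx) ?_
  rintro ⟨x, hx⟩ ⟨y, hy⟩ h
  have h' : (p : WittVector p k) ^ n • x = (p : WittVector p k) ^ n • y := congrArg Subtype.val h
  rw [← algebraMap_smul K(p, k), ← algebraMap_smul K(p, k) _ y, map_pow, map_natCast] at h'
  exact Subtype.ext (smul_right_injective _ (pow_ne_zero n (natCast_p_ne_zero p k)) h')

lemma sigmaK_pow_smul_mem_range (n : ℕ) (x : K(p, k)) :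
    (p : WittVector p k) ^ n • sigmaK p k x ∈ (algebraMap (WittVector p k) K(p, k)).range ↔
      (p : WittVector p k) ^ n • x ∈ (algebraMap (WittVector p k) K(p, k)).range := by
  have h : (p : WittVector p k) ^ n • sigmaK p k x = sigmaK p k ((p : WittVector p k) ^ n • x) := by
    rw [sigmaK_smul, map_pow, map_natCast]
  rw [h]
  constructor
  · rintro ⟨w, hw⟩
    refine ⟨(frobeniusEquiv p k).symm w, (sigmaK p k).injective ?_⟩
    rw [sigmaK_algebraMap, RingEquiv.apply_symm_apply, hw]
  · rintro ⟨w, hw⟩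
    exact ⟨frobeniusEquiv p k w, by rw [← sigmaK_algebraMap, hw]⟩

lemma tauMap_mem_boundedLattice (n : ℕ) (x : Nspace p k g) :
    tauMap p k g x ∈ boundedLattice p k g n ↔ x ∈ boundedLattice p k g n := by
  simp only [mem_boundedLattice, tauMap, sigmaK_pow_smul_mem_range]

lemma exists_le_boundedLattice {M : Submodule (WittVector p k) (Nspace p k g)} (hM : M.FG) :
    ∃ n, M ≤ boundedLattice p k g n := by
  obtain ⟨s, rfl⟩ := hM
  obtain ⟨⟨b, hb0⟩, hb⟩ := IsLocalization.exist_integer_multiples_of_finite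
    (nonZeroDivisors (WittVector p k))
    (fun q : s × (Fin g ⊕ Fin g) => (Sum.elim q.1.1.1 q.1.1.2 q.2 : K(p, k)))
  obtain ⟨n, hn⟩ := IsDiscreteValuationRing.associated_pow_irreducible
    (nonZeroDivisors.ne_zero hb0) (WittVector.irreducible p)
  obtain ⟨u, hu⟩ := hn
  have key : ∀ x : K(p, k), IsLocalization.IsInteger (WittVector p k) (b • x) →
      (p : WittVector p k) ^ n • x ∈ (algebraMap (WittVector p k) K(p, k)).range := by
    rintro x ⟨w, hw⟩
    refine ⟨u * w, ?_⟩
    rw [map_mul, hw, ← Algebra.smul_def, smul_smul, mul_comm, hu]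
  refine ⟨n, Submodule.span_le.2 fun x hx => (mem_boundedLattice p k g).2 ⟨fun i => ?_, fun i => ?_⟩⟩
  · exact key _ (hb (⟨x, hx⟩, Sum.inl i))
  · exact key _ (hb (⟨x, hx⟩, Sum.inr i))

end Concrete

/-- Let `v ∈ N` be such that `M := 𝒟v` is a `W`-lattice and set
`Λ₀ = M_τ`. For every `0 ≤ j ≤ g−1`:
(i) `M ∩ F^j(Λ₀)` equals the sum of the `W`-span of the `j+1` vectors `F^a V^b v`
(`a+b = j`) and `M ∩ F^{j+1}(Λ₀)`; and
(ii) if `∑_{a+b=j} c_{a,b} F^a V^b v ∈ F^{j+1}(Λ₀)` with `c_{a,b} ∈ W`, then every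
`c_{a,b}` is divisible by `p`. -/
theorem stmt9 (hg : 1 ≤ g) (v : Nspace p k g) (hv : IsLattice p k g (Dspan p k g v)) :
    ∀ j : ℕ, j ≤ g - 1 →
      ((Dspan p k g v : Set (Nspace p k g)) ∩
          (Fmap p k g)^[j] '' (Mtau p k g (Dspan p k g v) : Set (Nspace p k g))
        = {w | ∃ c : Fin (j + 1) → WittVector p k,
            ∃ m ∈ (Dspan p k g v : Set (Nspace p k g)) ∩
              (Fmap p k g)^[j + 1] '' (Mtau p k g (Dspan p k g v) : Set (Nspace p k g)),
            w = (∑ a : Fin (j + 1),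
                c a • (Fmap p k g)^[(a : ℕ)] ((Vmap p k g)^[j - (a : ℕ)] v)) + m}) ∧
      ∀ c : Fin (j + 1) → WittVector p k,
        (∑ a : Fin (j + 1), c a • (Fmap p k g)^[(a : ℕ)] ((Vmap p k g)^[j - (a : ℕ)] v))
            ∈ (Fmap p k g)^[j + 1] '' (Mtau p k g (Dspan p k g v) : Set (Nspace p k g)) →
        ∀ a : Fin (j + 1), ∃ d : WittVector p k, c a = (p : WittVector p k) * d := by
  intro j hj
  let F := FmapLin p k g
  let T := tauEquiv p k g
  let V := Vmap p k g
  have hDspan : Dspan p k g v = wordSpan F V v 0 := by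
    simp only [Dspan, wordSpan, zero_le, true_and]
    rfl
  rw [hDspan] at hv ⊢
  set L := iterateSpan T (wordSpan F V v 0) with hLdef
  have hMtau : Mtau p k g (wordSpan F V v 0) = L := rfl
  have hfil : ∀ n, (Fmap p k g)^[n] '' (L : Set (Nspace p k g)) = frobFil F L n := fun n =>
    (coe_frobFil F L n).symm
  rw [hMtau, hfil, hfil]
  have hV : ∀ x, T (V x) = F x := tauMap_Vmap p k g
  have hcomm : ∀ x, F (T x) = T (F x) := Fmap_tauMap p k g
  have hFF : ∀ x, F (F x) = (p : WittVector p k) • T x := Fmap_Fmap p k g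
  have hFV : ∀ x, F (V x) = (p : WittVector p k) • x := Fmap_Vmap p k g
  have hσ : frobW p k (p : WittVector p k) = p := map_natCast _ _
  obtain ⟨n, hn⟩ := exists_le_boundedLattice p k g hv.1
  have hLP : L ≤ boundedLattice p k g n :=
    iterateSpan_le hn fun x => (tauMap_mem_boundedLattice p k g n x).2
  have hTL : ∀ x, T x ∈ L ↔ x ∈ L := map_mem_iff_of_isNoetherian hLP
    (tauMap_mem_boundedLattice p k g n) fun x => map_mem_iterateSpan
  have hfg : L.FG := isNoetherian_submodule.1 inferInstance L hLP
  have hrank := two_mul_le_card_of_le_span p k g (L := L)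
    (top_unique (hv.2.symm.le.trans (Submodule.span_mono (le_iterateSpan _))))
  have hF : L.map F ≤ L := map_iterateSpan_le hcomm map_wordSpan_zero_le
  have hvL : v ∈ L := le_iterateSpan _ (Submodule.subset_span ⟨0, 0, le_rfl, rfl⟩)
  have hgen := iterateSpan_le_span_sup hV hcomm hTL
  have hword : ∀ a b, F^[a] (V^[b] v) ∈ frobFil F L (a + b) := word_mem_frobFil hV hcomm hTL hvL
  have hind : ∀ j < g, ∀ c : Fin (j + 1) → WittVector p k,
      ∑ a, c a • F^[(a : ℕ)] (V^[j - (a : ℕ)] v) ∈ frobFil F L (j + 1) →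
        ∀ a, (p : WittVector p k) ∣ c a := fun j hj => dvd_of_sum_word_mem hV hcomm
    (Fmap_injective p k g) hσ (maximalIdeal_wittVector p k) hFF hF hTL hfg hrank hvL hgen hj
  refine ⟨Set.ext fun w => ⟨?_, ?_⟩, hind j (by omega)⟩
  · rintro hw
    obtain ⟨e, he, m, hm, rfl⟩ := Submodule.mem_sup.1
      (wordSpan_le j (wordSpan_inf_frobFil_le hσ hFV hF hword hind (by omega) hw))
    obtain ⟨c, rfl⟩ := (Submodule.mem_span_range_iff_exists_fun _).1 he
    exact ⟨c, m, ⟨wordSpan_le_zero _ hm, wordSpan_le_frobFil hF hword _ hm⟩, rfl⟩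
  · rintro ⟨c, m, ⟨hm0, hm⟩, rfl⟩
    refine ⟨Submodule.add_mem _ (Submodule.sum_mem _ fun a _ => Submodule.smul_mem _ _
      (Submodule.subset_span ⟨_, _, Nat.zero_le _, rfl⟩)) hm0,
      Submodule.add_mem _ (Submodule.sum_mem _ fun a _ => Submodule.smul_mem _ _ ?_)
        (frobFil_succ_le hF j hm)⟩
    have h := hword a (j - a)
    rwa [Nat.add_sub_cancel' (by omega)] at h
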